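/- Euler's identity for the q-exponential E_q: for complex numbers q, z with |q| < 1, the series ∑_{k=0}^∞ (q^{k(k−1)/2} / (q;q)_k) z^k converges for all z ∈ ℂ and equals the infinite product (−z;q)_∞. -/

import Mathlib

/-- The finite `q`-shifted factorial `(a;q)_k`. -/
noncomputable def qPoch (a q : ℂ) (k : ℕ) : ℂ := ∏ j ∈ Finset.range k, (1 - a * q ^ j)

/-- The infinite `q`-shifted factorial `(a;q)_∞`. -/
noncomputable def qPochInf (a q : ℂ) : ℂ := ∏' j : ℕ, (1 - a * q ^ j)

theorem one_sub_pow_succ_ne_zero {q : ℂ} (hq : ‖q‖ < 1) (k : ℕ) : 1 - q ^ (k + 1) ≠ 0 := by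
  intro h
  have h1 : ‖q ^ (k + 1)‖ < 1 := by
    rw [norm_pow]
    exact pow_lt_one₀ (norm_nonneg q) hq k.succ_ne_zero
  rw [← sub_eq_zero.mp h, norm_one] at h1
  exact lt_irrefl _ h1

theorem qPoch_succ (a q : ℂ) (k : ℕ) : qPoch a q (k + 1) = qPoch a q k * (1 - a * q ^ k) :=
  Finset.prod_range_succ _ _

/-- The `k`-th Taylor coefficient of the `q`-exponential `E_q`. -/
noncomputable def qExpCoeff (q : ℂ) (k : ℕ) : ℂ := q ^ (k * (k - 1) / 2) / qPoch q q k

theorem qExpCoeff_zero (q : ℂ) : qExpCoeff q 0 = 1 := by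
  simp [qExpCoeff, qPoch]

theorem qExpCoeff_succ (q : ℂ) (k : ℕ) :
    qExpCoeff q (k + 1) = qExpCoeff q k * (q ^ k / (1 - q ^ (k + 1))) := by
  have h : (k + 1) * (k + 1 - 1) / 2 = k * (k - 1) / 2 + k := by
    rw [← Nat.choose_two_right, ← Nat.choose_two_right, Nat.choose_succ_succ' k 1,
      Nat.choose_one_right, add_comm]
  rw [qExpCoeff, qExpCoeff, h, qPoch_succ, pow_add, mul_div_mul_comm, ← pow_succ']

theorem summable_qExpCoeff_mul_pow {q : ℂ} (hq : ‖q‖ < 1) (z : ℂ) :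
    Summable fun k => qExpCoeff q k * z ^ k := by
  have hpow := tendsto_pow_atTop_nhds_zero_of_norm_lt_one hq
  have hlim : Filter.Tendsto (fun k => ‖q ^ k / (1 - q ^ (k + 1)) * z‖) Filter.atTop (nhds 0) := by
    have h := ((hpow.div ((hpow.comp (Filter.tendsto_add_atTop_nat 1)).const_sub 1)
      (by simp)).mul_const z).norm
    simpa using h
  refine summable_of_ratio_norm_eventually_le (r := 1 / 2) (by norm_num) ?_
  filter_upwards [hlim.eventually_le_const (by norm_num : (0 : ℝ) < 1 / 2)] with k hk
  have h : qExpCoeff q (k + 1) * z ^ (k + 1) =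
      q ^ k / (1 - q ^ (k + 1)) * z * (qExpCoeff q k * z ^ k) := by
    rw [qExpCoeff_succ]
    ring
  rw [h, norm_mul]
  gcongr

theorem tsum_qExpCoeff_eq_one_add_mul {q : ℂ} (hq : ‖q‖ < 1) (z : ℂ) :
    ∑' k, qExpCoeff q k * z ^ k = (1 + z) * ∑' k, qExpCoeff q k * (q * z) ^ k := by
  have hs := summable_qExpCoeff_mul_pow hq z
  have hs' := summable_qExpCoeff_mul_pow hq (q * z)
  have hterm (k : ℕ) : qExpCoeff q (k + 1) * z ^ (k + 1) =
      qExpCoeff q (k + 1) * (q * z) ^ (k + 1) + z * (qExpCoeff q k * (q * z) ^ k) := by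
    rw [qExpCoeff_succ]
    field_simp [one_sub_pow_succ_ne_zero hq k]
    ring
  rw [add_mul, one_mul, hs.tsum_eq_zero_add, tsum_congr hterm,
    ((summable_nat_add_iff 1).mpr hs').tsum_add (hs'.mul_left z), tsum_mul_left,
    hs'.tsum_eq_zero_add]
  simp only [pow_zero]
  ring

theorem tsum_qExpCoeff_eq_prod_mul {q : ℂ} (hq : ‖q‖ < 1) (z : ℂ) (n : ℕ) :
    ∑' k, qExpCoeff q k * z ^ k = qPoch (-z) q n * ∑' k, qExpCoeff q k * (q ^ n * z) ^ k := by
  induction n with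
  | zero => simp [qPoch]
  | succ n ih =>
    rw [ih, tsum_qExpCoeff_eq_one_add_mul hq (q ^ n * z), qPoch_succ, ← mul_assoc q, ← pow_succ']
    ring

theorem tendsto_tsum_qExpCoeff {q : ℂ} (hq : ‖q‖ < 1) (z : ℂ) :
    Filter.Tendsto (fun n : ℕ => ∑' k, qExpCoeff q k * (q ^ n * z) ^ k) Filter.atTop (nhds 1) := by
  have h0 : ∑' k, qExpCoeff q k * (0 : ℂ) ^ k = 1 := by
    rw [tsum_eq_single 0 (fun k hk => by simp [hk]), qExpCoeff_zero, pow_zero, one_mul]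
  rw [← h0]
  refine tendsto_tsum_of_dominated_convergence (summable_qExpCoeff_mul_pow hq z).norm
    (fun k => ?_) (.of_forall fun n k => ?_)
  · have h := (tendsto_pow_atTop_nhds_zero_of_norm_lt_one hq).mul_const z
    rw [zero_mul] at h
    exact (h.pow k).const_mul _
  · rw [norm_mul, norm_mul, norm_pow, norm_pow, norm_mul, norm_pow]
    gcongr
    exact mul_le_of_le_one_left (norm_nonneg z) (pow_le_one₀ (norm_nonneg q) hq.le)

theorem tendsto_qPoch {q : ℂ} (hq : ‖q‖ < 1) (a : ℂ) :
    Filter.Tendsto (qPoch a q) Filter.atTop (nhds (qPochInf a q)) := by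
  have h : Multipliable fun j : ℕ => 1 - a * q ^ j := by
    simp only [sub_eq_add_neg]
    refine multipliable_one_add_of_summable ?_
    simp only [norm_neg, norm_mul, norm_pow]
    exact (summable_geometric_of_lt_one (norm_nonneg q) hq).mul_left _
  exact h.hasProd.tendsto_prod_nat

/-- Euler's identity for the `q`-exponential `E_q`: for `‖q‖ < 1` and any `z ∈ ℂ`,
`∑_{k=0}^∞ (q^{k(k−1)/2} / (q;q)_k) z^k = (−z;q)_∞`. -/
theorem q_exponential_Eq (q z : ℂ) (hq : ‖q‖ < 1) :
    HasSum (fun k : ℕ => q ^ (k * (k - 1) / 2) / qPoch q q k * z ^ k)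
      (qPochInf (-z) q) := by
  have h := (tendsto_qPoch hq (-z)).mul (tendsto_tsum_qExpCoeff hq z)
  simp only [← tsum_qExpCoeff_eq_prod_mul hq z, mul_one] at h
  rw [← tendsto_nhds_unique tendsto_const_nhds h]
  exact (summable_qExpCoeff_mul_pow hq z).hasSum
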